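/- With the channel setup, explicit Gaussian Han–Kobayashi quantities, and region R_2 defined below, for every pair (R1,R2) ∈ R_2 it is not the case that both R1 > Ia1 + IW1 and R2 > Ia2 + IW2 hold; that is, at most one of the two inequalities R1 ≤ Ia1 + IW1 and R2 ≤ Ia2 + IW2 can fail for a point of R_2. -/

import Mathlib

open Matrix ComplexOrder

/-- Base-2 logarithm of the (real part of the) determinant. -/
noncomputable def logdet {n : ℕ} (A : Matrix (Fin n) (Fin n) ℂ) : ℝ :=
  Real.logb 2 A.det.re

/-- `KK H ρ = (I + ρ·H†·H)⁻¹`. -/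
noncomputable def KK {m n : ℕ} (H : Matrix (Fin n) (Fin m) ℂ) (ρ : ℝ) :
    Matrix (Fin m) (Fin m) ℂ :=
  (1 + (ρ : ℂ) • (Hᴴ * H))⁻¹

/-- `Ku H ρ = (1/m)·(I + ρ·H†·H)⁻¹` where `m` is the column dimension. -/
noncomputable def Ku {m n : ℕ} (H : Matrix (Fin n) (Fin m) ℂ) (ρ : ℝ) :
    Matrix (Fin m) (Fin m) ℂ :=
  ((m : ℂ))⁻¹ • KK H ρ

/-- `τ_{ji}` at receiver `i`. -/
noncomputable def tauI {mc n : ℕ} (Hc : Matrix (Fin n) (Fin mc) ℂ) (ρc : ℝ) : ℝ :=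
  logdet (1 + (ρc : ℂ) • (Hc * Ku Hc ρc * Hcᴴ))

/-- `Ia_i = log det(I + ρd·Hd·Kdu·Hd† + ρc·Hc·Kcu·Hc†) − τ`. -/
noncomputable def Ia {md mc n nx : ℕ} (Hd : Matrix (Fin n) (Fin md) ℂ)
    (Hc : Matrix (Fin n) (Fin mc) ℂ) (Hx : Matrix (Fin nx) (Fin md) ℂ)
    (ρd ρx ρc : ℝ) : ℝ :=
  logdet (1 + (ρd : ℂ) • (Hd * Ku Hx ρx * Hdᴴ) + (ρc : ℂ) • (Hc * Ku Hc ρc * Hcᴴ))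
    - tauI Hc ρc

/-- `IW_j` at receiver `i`: `log det(I + (ρc/mc)·Hc·Hc†) − τ`. -/
noncomputable def IWc {mc n : ℕ} (Hc : Matrix (Fin n) (Fin mc) ℂ) (ρc : ℝ) : ℝ :=
  logdet (1 + ((ρc / mc : ℝ) : ℂ) • (Hc * Hcᴴ)) - tauI Hc ρc

/-- `Id_i = log det(I + (ρd/md)·Hd·Hd† + ρc·Hc·Kcu·Hc†) − τ`. -/
noncomputable def Id' {md mc n : ℕ} (Hd : Matrix (Fin n) (Fin md) ℂ)
    (Hc : Matrix (Fin n) (Fin mc) ℂ) (ρd ρc : ℝ) : ℝ :=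
  logdet (1 + ((ρd / md : ℝ) : ℂ) • (Hd * Hdᴴ) + (ρc : ℂ) • (Hc * Ku Hc ρc * Hcᴴ))
    - tauI Hc ρc

/-- `Ie_i = log det(I + (ρc/mc)·Hc·Hc† + ρd·Hd·Kdu·Hd†) − τ`. -/
noncomputable def Ie {md mc n nx : ℕ} (Hd : Matrix (Fin n) (Fin md) ℂ)
    (Hc : Matrix (Fin n) (Fin mc) ℂ) (Hx : Matrix (Fin nx) (Fin md) ℂ)
    (ρd ρx ρc : ℝ) : ℝ :=
  logdet (1 + ((ρc / mc : ℝ) : ℂ) • (Hc * Hcᴴ) + (ρd : ℂ) • (Hd * Ku Hx ρx * Hdᴴ))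
    - tauI Hc ρc

/-- `Ig_i = log det(I + (ρc/mc)·Hc·Hc† + (ρd/md)·Hd·Hd†) − τ`. -/
noncomputable def Ig {md mc n : ℕ} (Hd : Matrix (Fin n) (Fin md) ℂ)
    (Hc : Matrix (Fin n) (Fin mc) ℂ) (ρd ρc : ℝ) : ℝ :=
  logdet (1 + ((ρc / mc : ℝ) : ℂ) • (Hc * Hcᴴ) + ((ρd / md : ℝ) : ℂ) • (Hd * Hdᴴ))
    - tauI Hc ρc

/-- The region `R_2`: nonnegative rate pairs `(R1,R2)` satisfying
`R1 ≤ Id1`, `R2 ≤ Id2`, `R1+R2 ≤ Ig2+Ia1`, `R1+R2 ≤ Ig1+Ia2`, `R1+R2 ≤ Ie1+Ie2`,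
`2R1+R2 ≤ Ig1+Ia1+Ie2`, `R1+2R2 ≤ Ig2+Ia2+Ie1`. -/
noncomputable def R2set {M1 N1 M2 N2 : ℕ}
    (H11 : Matrix (Fin N1) (Fin M1) ℂ) (H12 : Matrix (Fin N2) (Fin M1) ℂ)
    (H21 : Matrix (Fin N1) (Fin M2) ℂ) (H22 : Matrix (Fin N2) (Fin M2) ℂ)
    (ρ11 ρ12 ρ21 ρ22 : ℝ) : Set (ℝ × ℝ) :=
  {p : ℝ × ℝ | 0 ≤ p.1 ∧ 0 ≤ p.2 ∧
    p.1 ≤ Id' H11 H21 ρ11 ρ21 ∧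
    p.2 ≤ Id' H22 H12 ρ22 ρ12 ∧
    p.1 + p.2 ≤ Ig H22 H12 ρ22 ρ12 + Ia H11 H21 H12 ρ11 ρ12 ρ21 ∧
    p.1 + p.2 ≤ Ig H11 H21 ρ11 ρ21 + Ia H22 H12 H21 ρ22 ρ21 ρ12 ∧
    p.1 + p.2 ≤ Ie H11 H21 H12 ρ11 ρ12 ρ21 + Ie H22 H12 H21 ρ22 ρ21 ρ12 ∧
    2 * p.1 + p.2 ≤ Ig H11 H21 ρ11 ρ21 + Ia H11 H21 H12 ρ11 ρ12 ρ21
        + Ie H22 H12 H21 ρ22 ρ21 ρ12 ∧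
    p.1 + 2 * p.2 ≤ Ig H22 H12 ρ22 ρ12 + Ia H22 H12 H21 ρ22 ρ21 ρ12
        + Ie H11 H21 H12 ρ11 ρ12 ρ21}

open scoped MatrixOrder in
/-- A positive semidefinite matrix factors as `X * Xᴴ`. -/
theorem Matrix.PosSemidef.exists_eq_mul_conjTranspose {n : ℕ} {A : Matrix (Fin n) (Fin n) ℂ}
    (hA : A.PosSemidef) : ∃ X : Matrix (Fin n) (Fin n) ℂ, A = X * Xᴴ := by
  obtain ⟨X, hX⟩ := CStarAlgebra.nonneg_iff_eq_mul_star_self.mp hA.nonneg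
  exact ⟨X, hX⟩

/-- `1 ≤ det (1 + A)` for positive semidefinite `A`. -/
theorem Matrix.PosSemidef.one_le_det_one_add {n : ℕ} {A : Matrix (Fin n) (Fin n) ℂ}
    (hA : A.PosSemidef) : 1 ≤ (1 + A).det := by
  let U : Matrix (Fin n) (Fin n) ℂ := hA.1.eigenvectorUnitary
  let D : Matrix (Fin n) (Fin n) ℂ := diagonal fun i => (hA.1.eigenvalues i : ℂ)
  have hU : U * star U = 1 := Unitary.coe_mul_star_self _
  have hA' : A = U * (D * star U) := by
    rw [← mul_assoc]
    exact hA.1.spectral_theorem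
  have hdet : (1 + A).det = (1 + D).det := by
    rw [hA', det_one_add_mul_comm, mul_assoc, mul_eq_one_comm.mp hU, mul_one]
  have hD : 1 + D = diagonal fun i => 1 + (hA.1.eigenvalues i : ℂ) := by
    rw [← diagonal_one, diagonal_add]
  rw [hdet, hD, det_diagonal]
  have h : 1 ≤ ∏ i, (1 + hA.1.eigenvalues i) :=
    Finset.prod_induction _ (1 ≤ ·) (fun _ _ => one_le_mul_of_one_le_of_one_le) le_rfl
      fun i _ => le_add_of_nonneg_right (hA.eigenvalues_nonneg i)
  exact_mod_cast h

/-- The determinant is monotone in the Loewner order. -/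
theorem Matrix.PosDef.det_le_det_add {n : ℕ} {A B : Matrix (Fin n) (Fin n) ℂ}
    (hA : A.PosDef) (hB : B.PosSemidef) : A.det ≤ (A + B).det := by
  obtain ⟨X, rfl⟩ := hB.exists_eq_mul_conjTranspose
  rw [det_add_mul X Xᴴ hA.det_pos.ne'.isUnit]
  exact le_mul_of_one_le_right hA.det_pos.le
    (hA.inv.posSemidef.conjTranspose_mul_mul_same X).one_le_det_one_add

/-- The inverse is antitone in the Loewner order. -/
theorem Matrix.PosDef.posSemidef_inv_sub_inv_add {n : ℕ} {A B : Matrix (Fin n) (Fin n) ℂ}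
    (hA : A.PosDef) (hB : B.PosSemidef) : (A⁻¹ - (A + B)⁻¹).PosSemidef := by
  obtain ⟨X, rfl⟩ := hB.exists_eq_mul_conjTranspose
  have hC : (1 + Xᴴ * A⁻¹ * X).PosDef :=
    PosDef.one.add_posSemidef (hA.inv.posSemidef.conjTranspose_mul_mul_same X)
  have h := add_mul_mul_inv_eq_sub _ X _ Xᴴ hA.isUnit
    (isUnit_one (M := Matrix (Fin n) (Fin n) ℂ)) (by simpa using hC.isUnit)
  rw [mul_one, inv_one] at h
  rw [h, sub_sub_cancel]
  have key := hC.inv.posSemidef.mul_mul_conjTranspose_same (A⁻¹ * X)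
  rwa [conjTranspose_mul, hA.inv.isHermitian.eq, ← mul_assoc] at key

/-- Submodularity of the determinant on positive definite matrices. -/
theorem Matrix.PosDef.det_add_add_mul_det_le {n : ℕ} {A B C : Matrix (Fin n) (Fin n) ℂ}
    (hA : A.PosDef) (hB : B.PosSemidef) (hC : C.PosSemidef) :
    (A + B + C).det * A.det ≤ (A + B).det * (A + C).det := by
  have hAB := hA.add_posSemidef hB
  obtain ⟨X, rfl⟩ := hC.exists_eq_mul_conjTranspose
  rw [det_add_mul X Xᴴ hA.det_pos.ne'.isUnit, det_add_mul X Xᴴ hAB.det_pos.ne'.isUnit]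
  have h1 : (1 + Xᴴ * (A + B)⁻¹ * X).det ≤ (1 + Xᴴ * A⁻¹ * X).det := by
    have h := (PosDef.one.add_posSemidef
      (hAB.inv.posSemidef.conjTranspose_mul_mul_same X)).det_le_det_add
      ((hA.posSemidef_inv_sub_inv_add hB).conjTranspose_mul_mul_same X)
    convert h using 2
    noncomm_ring
  calc _ = (A + B).det * A.det * (1 + Xᴴ * (A + B)⁻¹ * X).det := by ring
    _ ≤ (A + B).det * A.det * (1 + Xᴴ * A⁻¹ * X).det :=
      mul_le_mul_of_nonneg_left h1 (mul_nonneg hAB.det_pos.le hA.det_pos.le)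
    _ = _ := by ring

/-- Submodularity of `logdet` on positive definite matrices. -/
theorem logdet_add_add_add_logdet_le {n : ℕ} {A B C : Matrix (Fin n) (Fin n) ℂ}
    (hA : A.PosDef) (hB : B.PosSemidef) (hC : C.PosSemidef) :
    logdet (A + B + C) + logdet A ≤ logdet (A + B) + logdet (A + C) := by
  have hAB := hA.add_posSemidef hB
  have re_pos {P : Matrix (Fin n) (Fin n) ℂ} (hP : P.PosDef) : 0 < P.det.re :=
    (Complex.pos_iff.mp hP.det_pos).1
  have re_mul {P Q : Matrix (Fin n) (Fin n) ℂ} (hP : P.PosDef) :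
      (P.det * Q.det).re = P.det.re * Q.det.re := by
    simp [Complex.mul_re, ← (Complex.pos_iff.mp hP.det_pos).2]
  have h := (Complex.le_def.mp (hA.det_add_add_mul_det_le hB hC)).1
  have hABC := hAB.add_posSemidef hC
  have hAC := hA.add_posSemidef hC
  rw [re_mul hABC, re_mul hAB] at h
  unfold logdet
  rw [← Real.logb_mul (re_pos hABC).ne' (re_pos hA).ne',
    ← Real.logb_mul (re_pos hAB).ne' (re_pos hAC).ne']
  exact Real.logb_le_logb_of_le one_lt_two (mul_pos (re_pos hABC) (re_pos hA)) h

theorem posDef_one_add_smul {m n : ℕ} (H : Matrix (Fin n) (Fin m) ℂ) {ρ : ℝ} (hρ : 0 ≤ ρ) :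
    (1 + (ρ : ℂ) • (Hᴴ * H)).PosDef :=
  PosDef.one.add_posSemidef
    ((posSemidef_conjTranspose_mul_self H).smul (Complex.zero_le_real.mpr hρ))

theorem Ku_posSemidef {m n : ℕ} (H : Matrix (Fin n) (Fin m) ℂ) {ρ : ℝ} (hρ : 0 ≤ ρ) :
    (Ku H ρ).PosSemidef :=
  (posDef_one_add_smul H hρ).inv.posSemidef.smul (by positivity)

/-- The private covariance `Ku` is dominated by the full covariance `m⁻¹ • 1`. -/
theorem posSemidef_inv_smul_one_sub_Ku {m n : ℕ} (H : Matrix (Fin n) (Fin m) ℂ) {ρ : ℝ}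
    (hρ : 0 ≤ ρ) : ((m : ℂ)⁻¹ • 1 - Ku H ρ).PosSemidef := by
  have h := (PosDef.one (n := Fin m) (R := ℂ)).posSemidef_inv_sub_inv_add
    ((posSemidef_conjTranspose_mul_self H).smul (Complex.zero_le_real.mpr hρ))
  rw [inv_one] at h
  rw [Ku, KK, ← smul_sub]
  exact h.smul (by positivity)

/-- `Ie ≤ Ia + IW`: splitting off the interfering common message can only help. -/
theorem Ie_le_Ia_add_IWc {md mc n nx : ℕ} (Hd : Matrix (Fin n) (Fin md) ℂ)
    (Hc : Matrix (Fin n) (Fin mc) ℂ) (Hx : Matrix (Fin nx) (Fin md) ℂ)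
    {ρd ρx ρc : ℝ} (hd : 0 ≤ ρd) (hx : 0 ≤ ρx) (hc : 0 ≤ ρc) :
    Ie Hd Hc Hx ρd ρx ρc ≤ Ia Hd Hc Hx ρd ρx ρc + IWc Hc ρc := by
  have hc' : (0 : ℂ) ≤ ρc := Complex.zero_le_real.mpr hc
  have hA : (1 + (ρc : ℂ) • (Hc * Ku Hc ρc * Hcᴴ)).PosDef := PosDef.one.add_posSemidef
    (((Ku_posSemidef Hc hc).mul_mul_conjTranspose_same Hc).smul hc')
  have hB := ((Ku_posSemidef Hx hx).mul_mul_conjTranspose_same Hd).smul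
    (Complex.zero_le_real.mpr hd)
  have hC := ((posSemidef_inv_smul_one_sub_Ku Hc hc).mul_mul_conjTranspose_same Hc).smul hc'
  have hsum : 1 + (ρc : ℂ) • (Hc * Ku Hc ρc * Hcᴴ)
      + (ρc : ℂ) • (Hc * ((mc : ℂ)⁻¹ • 1 - Ku Hc ρc) * Hcᴴ)
      = 1 + ((ρc / mc : ℝ) : ℂ) • (Hc * Hcᴴ) := by
    rw [add_assoc, ← smul_add, ← Matrix.add_mul, ← Matrix.mul_add, add_sub_cancel]
    simp [smul_smul, div_eq_mul_inv]
  have h := logdet_add_add_add_logdet_le hA hC hB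
  rw [hsum, add_right_comm 1 ((ρc : ℂ) • _)] at h
  unfold Ie Ia IWc tauI
  linarith

/-- first step of Lemma 5 of the paper. For every rate pair of `R_2`,
it cannot be that simultaneously `R1 > Ia1 + IW1` and `R2 > Ia2 + IW2`: at most one of
the two constraints `R1 ≤ Ia1 + IW1` and `R2 ≤ Ia2 + IW2` can fail on `R_2`. -/
theorem stmt_19 (M1 N1 M2 N2 : ℕ) (hM1 : 0 < M1) (hN1 : 0 < N1) (hM2 : 0 < M2) (hN2 : 0 < N2)
    (H11 : Matrix (Fin N1) (Fin M1) ℂ) (H12 : Matrix (Fin N2) (Fin M1) ℂ)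
    (H21 : Matrix (Fin N1) (Fin M2) ℂ) (H22 : Matrix (Fin N2) (Fin M2) ℂ)
    (ρ11 ρ12 ρ21 ρ22 : ℝ) (h11 : 0 ≤ ρ11) (h12 : 0 ≤ ρ12) (h21 : 0 ≤ ρ21) (h22 : 0 ≤ ρ22)
    (R1 R2 : ℝ) (hmem : (R1, R2) ∈ R2set H11 H12 H21 H22 ρ11 ρ12 ρ21 ρ22) :
    ¬ (Ia H11 H21 H12 ρ11 ρ12 ρ21 + IWc H12 ρ12 < R1 ∧
       Ia H22 H12 H21 ρ22 ρ21 ρ12 + IWc H21 ρ21 < R2) := by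
  rintro ⟨h1, h2⟩
  obtain ⟨-, -, -, -, -, -, h, -, -⟩ := hmem
  have e1 := Ie_le_Ia_add_IWc H11 H21 H12 h11 h12 h21
  have e2 := Ie_le_Ia_add_IWc H22 H12 H21 h22 h21 h12
  linarith
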